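/- Let n ≥ 4 and k ≥ 1 be integers with 2k ≤ n, let a < b be real numbers, and let c₁, …, c_n be real numbers. Then there exist real numbers b > z₂ > z₃ > ⋯ > z_k > a with z_s ≠ 0 for all s = 2,…,k, and real numbers σ₁, …, σ_k > 0 such that c_j = b^{j−1}σ₁ + Σ_{s=2}^{k} z_s^{j−1} σ_s for every j = 1, …, n, if and only if the following three conditions hold: (C₁) det {c^{b}_{i+j−1+d}}_{i,j=1}^{k} = 0 for every integer d with 0 ≤ d ≤ n − 2k; (C₂) the (k−1)×(k−1) Hankel matrices {c^{b}_{i+j−1}}_{i,j=1}^{k−1} and {c^{b}_{i+j+1}}_{i,j=1}^{k−1} are positive definite; (C₃) the k×k Hankel matrix {c^{a}_{i+j−1}}_{i,j=1}^{k} is positive definite. -/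

import Mathlib

section

open Finset Polynomial

/-- The linear functional on real polynomials with moments `g`. -/
noncomputable def momentFunctional (g : ℕ → ℝ) : ℝ[X] →ₗ[ℝ] ℝ :=
  lsum fun j => g j • LinearMap.id

theorem momentFunctional_apply (g : ℕ → ℝ) {p : ℝ[X]} {N : ℕ} (hp : p.natDegree < N) :
    momentFunctional g p = ∑ j ∈ range N, g j * p.coeff j := by
  change (p.sum fun j x => (g j • LinearMap.id : ℝ →ₗ[ℝ] ℝ) x) = _
  rw [p.sum_over_range' (by simp) N hp]
  simp

@[simp]
theorem momentFunctional_X_pow (g : ℕ → ℝ) (j : ℕ) : momentFunctional g (X ^ j) = g j := by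
  rw [momentFunctional_apply g (N := j + 1) (by simp)]
  simp [coeff_X_pow]

theorem momentFunctional_congr {g h : ℕ → ℝ} {N : ℕ} (hgh : ∀ j < N, g j = h j) {p : ℝ[X]}
    (hp : p.natDegree < N) : momentFunctional g p = momentFunctional h p := by
  rw [momentFunctional_apply g hp, momentFunctional_apply h hp]
  exact sum_congr rfl fun j hj => by rw [hgh j (mem_range.1 hj)]

theorem momentFunctional_shift (g : ℕ → ℝ) (d : ℕ) (p : ℝ[X]) :
    momentFunctional (fun j => g (j + d)) p = momentFunctional g (X ^ d * p) := by
  have : momentFunctional (fun j => g (j + d)) =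
      momentFunctional g ∘ₗ LinearMap.mulLeft ℝ (X ^ d) := by
    ext j
    simp [← X_pow_eq_monomial, ← pow_add, add_comm]
  rw [this]; rfl

theorem momentFunctional_atomic {ι : Type*} (S : Finset ι) (z w : ι → ℝ) (p : ℝ[X]) :
    momentFunctional (fun j => ∑ s ∈ S, w s * z s ^ j) p = ∑ s ∈ S, w s * p.eval (z s) := by
  rw [momentFunctional_apply _ (Nat.lt_succ_self _)]
  simp_rw [eval_eq_sum_range, mul_sum, sum_mul]
  rw [sum_comm]
  exact sum_congr rfl fun s _ => sum_congr rfl fun j _ => by ring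

/-- The polynomial with coefficient vector `v`. -/
noncomputable def vecPoly {m : ℕ} (v : Fin m → ℝ) : ℝ[X] := ∑ i, v i • X ^ i.1

theorem coeff_vecPoly {m : ℕ} (v : Fin m → ℝ) (i : Fin m) : (vecPoly v).coeff i = v i := by
  simp [vecPoly, coeff_X_pow, Fin.val_inj]

theorem natDegree_vecPoly_lt {m : ℕ} {v : Fin m → ℝ} (hv : v ≠ 0) :
    (vecPoly v).natDegree < m := by
  have hm : 0 < m := by
    rcases Nat.eq_zero_or_pos m with rfl | h
    · exact (hv (Subsingleton.elim _ _)).elim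
    · exact h
  refine (natDegree_sum_le_of_forall_le (n := m - 1) _ _ fun i _ => ?_).trans_lt (by omega)
  exact (natDegree_smul_le _ _).trans (by rw [natDegree_X_pow]; omega)

theorem vecPoly_ne_zero {m : ℕ} {v : Fin m → ℝ} (hv : v ≠ 0) : vecPoly v ≠ 0 := by
  contrapose! hv
  ext i
  rw [← coeff_vecPoly v i, hv]; simp

theorem vecPoly_coeff {m : ℕ} {p : ℝ[X]} (hp : p.natDegree < m) :
    vecPoly (fun i : Fin m => p.coeff i) = p := by
  conv_rhs => rw [p.as_sum_range' m hp]
  rw [vecPoly, Fin.sum_univ_eq_sum_range (fun i => p.coeff i • (X : ℝ[X]) ^ i)]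
  simp [← C_mul_X_pow_eq_monomial, smul_eq_C_mul]

open Matrix in
theorem momentFunctional_vecPoly_mul (g : ℕ → ℝ) {m : ℕ} (v w : Fin m → ℝ) :
    momentFunctional g (vecPoly v * vecPoly w) =
      v ⬝ᵥ (Matrix.of fun i j : Fin m => g (i.1 + j.1)) *ᵥ w := by
  rw [vecPoly, vecPoly, sum_mul_sum]
  simp only [map_sum, smul_mul_smul_comm, ← pow_add, map_smul,
    momentFunctional_X_pow, dotProduct, mulVec, mul_sum, smul_eq_mul, of_apply]
  exact sum_congr rfl fun i _ => sum_congr rfl fun j _ => by ring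

theorem posDef_hankel_iff (g : ℕ → ℝ) (m : ℕ) :
    (Matrix.of fun i j : Fin m => g (i.1 + j.1)).PosDef ↔
      ∀ p : ℝ[X], p ≠ 0 → p.natDegree < m → 0 < momentFunctional g (p * p) := by
  constructor
  · intro h p hp hpm
    have := h.dotProduct_mulVec_pos (x := fun i : Fin m => p.coeff i) (by
      intro h0
      apply hp
      rw [← vecPoly_coeff hpm, h0]
      simp [vecPoly])
    rwa [star_trivial, ← momentFunctional_vecPoly_mul, vecPoly_coeff hpm] at this
  · intro h
    refine Matrix.PosDef.of_dotProduct_mulVec_pos ?_ fun v hv => ?_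
    · ext i j
      simp [add_comm]
    · rw [star_trivial, ← momentFunctional_vecPoly_mul]
      exact h _ (vecPoly_ne_zero hv) (natDegree_vecPoly_lt hv)

open Matrix in
theorem det_hankel_eq_zero_iff (g : ℕ → ℝ) (m : ℕ) :
    (Matrix.of fun i j : Fin m => g (i.1 + j.1)).det = 0 ↔
      ∃ q : ℝ[X], q ≠ 0 ∧ q.natDegree < m ∧
        ∀ r : ℝ[X], r.natDegree < m → momentFunctional g (q * r) = 0 := by
  rw [← Matrix.exists_mulVec_eq_zero_iff]
  constructor
  · rintro ⟨v, hv, h⟩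
    refine ⟨vecPoly v, vecPoly_ne_zero hv, natDegree_vecPoly_lt hv, fun r hr => ?_⟩
    rw [mul_comm, ← vecPoly_coeff hr, momentFunctional_vecPoly_mul, h, dotProduct_zero]
  · rintro ⟨q, hq, hqm, h⟩
    refine ⟨fun i => q.coeff i, fun h0 => hq ?_, ?_⟩
    · rw [← vecPoly_coeff hqm, h0]
      simp [vecPoly]
    · refine dotProduct_eq_zero _ fun w => ?_
      rw [dotProduct_comm, ← momentFunctional_vecPoly_mul, vecPoly_coeff hqm, mul_comm]
      by_cases hw : w = 0
      · simp [hw, vecPoly]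
      · exact h _ (natDegree_vecPoly_lt hw)

theorem natDegree_eq_of_orthogonal {g : ℕ → ℝ} {m : ℕ}
    (hpos : ∀ p : ℝ[X], p ≠ 0 → p.natDegree < m → 0 < momentFunctional g (p * p))
    {q : ℝ[X]} (hq : q ≠ 0) (hqm : q.natDegree < m + 1)
    (horth : ∀ r : ℝ[X], r.natDegree < m + 1 → momentFunctional g (q * r) = 0) :
    q.natDegree = m := by
  by_contra h
  have := hpos q hq (by omega)
  rw [horth q hqm] at this
  exact this.false

theorem splits_of_orthogonal {g : ℕ → ℝ} {m : ℕ}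
    (hpos : ∀ p : ℝ[X], p ≠ 0 → p.natDegree < m → 0 < momentFunctional g (p * p))
    {q : ℝ[X]} (hq : q ≠ 0) (hqm : q.natDegree < m + 1)
    (horth : ∀ r : ℝ[X], r.natDegree < m + 1 → momentFunctional g (q * r) = 0) :
    q.Splits := by
  refine Splits.of_splits_map (algebraMap ℝ ℂ) (IsAlgClosed.splits _) fun z hz => ?_
  have hz0 : aeval z q = 0 := by
    rw [mem_roots_map hq] at hz
    exact hz
  by_contra him
  have him : z.im ≠ 0 := fun h => him ⟨z.re, Complex.ext rfl (by simp [h])⟩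
  obtain ⟨h, rfl⟩ := q.quadratic_dvd_of_aeval_eq_zero_im_ne_zero hz0 him
  have hsq : (X ^ 2 - C (2 * z.re) * X + C (‖z‖ ^ 2) : ℝ[X]) =
      (X - C z.re) * (X - C z.re) + C (z.im ^ 2) := by
    rw [Complex.sq_norm, Complex.normSq_apply]
    simp only [map_mul, map_add, map_pow]
    rw [show (C 2 : ℝ[X]) = 2 from rfl]
    ring
  have hh : h ≠ 0 := right_ne_zero_of_mul hq
  have h2 : (X ^ 2 - C (2 * z.re) * X + C (‖z‖ ^ 2) : ℝ[X]).natDegree = 2 := by compute_degree!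
  rw [natDegree_mul (left_ne_zero_of_mul hq) hh, h2] at hqm
  have hX : (X - C z.re : ℝ[X]) ≠ 0 := X_sub_C_ne_zero _
  have h1 := hpos ((X - C z.re) * h) (mul_ne_zero hX hh) (by
    rw [natDegree_mul hX hh, natDegree_X_sub_C]; omega)
  have h3 := hpos h hh (by omega)
  have h4 := horth h (by omega)
  rw [hsq, show ((X - C z.re) * (X - C z.re) + C (z.im ^ 2)) * h * h =
    ((X - C z.re) * h) * ((X - C z.re) * h) + (z.im ^ 2) • (h * h) by
      rw [smul_eq_C_mul]; ring, map_add, map_smul, smul_eq_mul] at h4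
  have : 0 < z.im ^ 2 := by positivity
  nlinarith

theorem nodup_roots_of_orthogonal {g : ℕ → ℝ} {m : ℕ}
    (hpos : ∀ p : ℝ[X], p ≠ 0 → p.natDegree < m → 0 < momentFunctional g (p * p))
    {q : ℝ[X]} (hq : q ≠ 0) (hqm : q.natDegree < m + 1)
    (horth : ∀ r : ℝ[X], r.natDegree < m + 1 → momentFunctional g (q * r) = 0) :
    q.roots.Nodup := by
  rw [Multiset.nodup_iff_count_le_one]
  intro x
  by_contra! hx
  rw [count_roots, ← Nat.succ_le_iff, le_rootMultiplicity_iff hq] at hx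
  obtain ⟨h, rfl⟩ := hx
  have hh : h ≠ 0 := right_ne_zero_of_mul hq
  have hX : (X - C x : ℝ[X]) ≠ 0 := X_sub_C_ne_zero _
  rw [natDegree_mul (left_ne_zero_of_mul hq) hh, natDegree_pow, natDegree_X_sub_C] at hqm
  have h1 := hpos ((X - C x) * h) (mul_ne_zero hX hh) (by
    rw [natDegree_mul hX hh, natDegree_X_sub_C]; omega)
  have h4 := horth h (by omega)
  rw [show (X - C x) ^ Nat.succ 1 * h * h = ((X - C x) * h) * ((X - C x) * h) by ring] at h4
  exact h1.ne' h4

theorem natDegree_basis_id {T : Finset ℝ} {t : ℝ} (ht : t ∈ T) :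
    (Lagrange.basis T id t).natDegree + 1 = #T := by
  rw [Lagrange.natDegree_basis (Set.injOn_id _) ht]
  have := card_pos.2 ⟨t, ht⟩
  omega

theorem sum_mul_eval_mul_basis {T : Finset ℝ} {t : ℝ} (ht : t ∈ T) (τ : ℝ → ℝ) (p : ℝ[X]) :
    ∑ s ∈ T, τ s * (p * Lagrange.basis T id t).eval s = τ t * p.eval t := by
  rw [sum_eq_single_of_mem t ht]
  · have := Lagrange.eval_basis_self (Set.injOn_id (T : Set ℝ)) ht
    rw [id] at this
    rw [eval_mul, this, mul_one]
  · intro s hs hst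
    have := Lagrange.eval_basis_of_ne (v := id) hst.symm hs
    rw [id] at this
    rw [eval_mul, this, mul_zero, mul_zero]

/-- Gauss quadrature: a moment functional that is positive on squares of polynomials of degree
less than `m` and has a nonzero orthogonal polynomial `q` of degree at most `m` is, up to
degree `2 * m`, a positive combination of evaluations at `m` distinct real roots of `q`. -/
theorem exists_gauss_quadrature {g : ℕ → ℝ} {m : ℕ}
    (hpos : ∀ p : ℝ[X], p ≠ 0 → p.natDegree < m → 0 < momentFunctional g (p * p))
    {q : ℝ[X]} (hq : q ≠ 0) (hqm : q.natDegree < m + 1)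
    (horth : ∀ r : ℝ[X], r.natDegree < m + 1 → momentFunctional g (q * r) = 0) :
    ∃ (T : Finset ℝ) (τ : ℝ → ℝ), #T = m ∧ (∀ t ∈ T, 0 < τ t) ∧ (∀ t ∈ T, q.eval t = 0) ∧
      ∀ p : ℝ[X], p.natDegree < 2 * m + 1 →
        momentFunctional g p = ∑ t ∈ T, τ t * p.eval t := by
  have hdeg := natDegree_eq_of_orthogonal hpos hq hqm horth
  have hcard : #q.roots.toFinset = m := by
    rw [Multiset.toFinset_card_of_nodup (nodup_roots_of_orthogonal hpos hq hqm horth),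
      ← (splits_of_orthogonal hpos hq hqm horth).natDegree_eq_card_roots, hdeg]
  set T := q.roots.toFinset with hT
  have hroot : ∀ t ∈ T, q.eval t = 0 := fun t ht => by simpa [hT, hq] using ht
  have hrep : ∀ p : ℝ[X], p.natDegree < 2 * m + 1 → momentFunctional g p =
      ∑ t ∈ T, momentFunctional g (Lagrange.basis T id t) * p.eval t := by
    intro p hp
    have hdiv := EuclideanDomain.div_add_mod p q
    have hqr : momentFunctional g (q * (p / q)) = 0 := by
      refine horth _ ?_
      rw [Polynomial.div_def]
      refine (natDegree_C_mul_le _ _).trans_lt ?_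
      rw [natDegree_divByMonic _ (monic_mul_leadingCoeff_inv hq), natDegree_mul_leadingCoeff_inv _ hq]
      omega
    have hmod : p % q = Lagrange.interpolate T id fun t => p.eval t := by
      refine Lagrange.eq_interpolate_of_eval_eq _ (Set.injOn_id _) ?_ fun t ht => ?_
      · rw [hcard, ← hdeg, ← degree_eq_natDegree hq]
        exact EuclideanDomain.mod_lt p hq
      · conv_rhs => rw [← hdiv]
        simp [hroot t ht]
    conv_lhs => rw [← hdiv, map_add, hqr, zero_add, hmod, Lagrange.interpolate_apply, map_sum]
    exact sum_congr rfl fun t _ => by rw [← smul_eq_C_mul, map_smul, smul_eq_mul, mul_comm]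
  refine ⟨T, fun t => momentFunctional g (Lagrange.basis T id t), hcard, fun t ht => ?_, hroot,
    hrep⟩
  have hb := natDegree_basis_id ht
  have h1 := hpos (Lagrange.basis T id t) (Lagrange.basis_ne_zero (Set.injOn_id _) ht) (by omega)
  rw [hrep _ (natDegree_mul_le.trans_lt (by omega)), sum_mul_eval_mul_basis ht] at h1
  have := Lagrange.eval_basis_self (Set.injOn_id (T : Set ℝ)) ht
  rw [id] at this
  rwa [this, mul_one] at h1

/-- Vanishing of the shifted Hankel determinants propagates an atomic representation. -/
theorem eq_sum_of_det_hankel_eq_zero {g : ℕ → ℝ} {m N : ℕ} {T : Finset ℝ} {τ : ℝ → ℝ}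
    (hcard : #T = m) (hτ : ∀ t ∈ T, τ t ≠ 0) (hT : ∀ t ∈ T, t ≠ 0)
    (hbase : ∀ j < 2 * m + 1, g j = ∑ t ∈ T, τ t * t ^ j)
    (hdet : ∀ d, 2 * m + d < N →
      (Matrix.of fun i j : Fin (m + 1) => g (i.1 + j.1 + d)).det = 0) :
    ∀ j < N, g j = ∑ t ∈ T, τ t * t ^ j := by
  intro j
  induction j using Nat.strong_induction_on with
  | _ j ih =>
  intro hj
  rcases lt_or_ge j (2 * m + 1) with hjm | hjm
  · exact hbase j hjm
  obtain ⟨d, rfl⟩ := Nat.exists_eq_add_of_le (show 2 * m ≤ j by omega)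
  obtain ⟨v, hv, hvm, horth⟩ :=
    (det_hankel_eq_zero_iff (fun j => g (j + d)) (m + 1)).1 (hdet d hj)
  simp only [momentFunctional_shift] at horth
  have hrep : ∀ p : ℝ[X], p.natDegree < 2 * m + d →
      momentFunctional g p = ∑ t ∈ T, τ t * p.eval t := fun p hp => by
    rw [momentFunctional_congr (fun i hi => ih i hi (by omega)) hp, momentFunctional_atomic]
  have hroot : ∀ t ∈ T, v.eval t = 0 := by
    intro t ht
    have hb := natDegree_basis_id ht
    have h1 := horth (Lagrange.basis T id t) (by omega)
    rw [← mul_assoc, hrep, sum_mul_eval_mul_basis ht] at h1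
    · simpa [hτ t ht, hT t ht] using h1
    · refine natDegree_mul_le.trans_lt ?_
      have := natDegree_mul_le (p := X ^ d) (q := v)
      rw [natDegree_X_pow] at this
      omega
  have hdeg : v.natDegree = m := by
    refine le_antisymm (by omega) ?_
    rw [← hcard]
    exact (card_le_card fun t ht => by simpa [hv] using hroot t ht).trans
      ((Multiset.toFinset_card_le _).trans (card_roots' v))
  have h1 := horth (X ^ m) (by simp)
  set h : ℕ → ℝ := fun j => ∑ t ∈ T, τ t * t ^ j with hh
  have h2 : momentFunctional h (X ^ d * (v * X ^ m)) = 0 := by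
    rw [hh, momentFunctional_atomic]
    exact sum_eq_zero fun t ht => by simp [hroot t ht]
  have hN : (X ^ d * (v * X ^ m)).natDegree < 2 * m + d + 1 := by
    refine natDegree_mul_le.trans_lt ?_
    have := natDegree_mul_le (p := v) (q := X ^ m)
    rw [natDegree_X_pow] at this ⊢
    omega
  rw [momentFunctional_apply _ hN, sum_range_succ] at h1 h2
  rw [sum_congr rfl fun i hi => by rw [ih i (mem_range.1 hi) (by have := mem_range.1 hi; omega)]]
    at h1
  have hc : (X ^ d * (v * X ^ m)).coeff (2 * m + d) ≠ 0 := by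
    rw [coeff_X_pow_mul, two_mul, coeff_mul_X_pow, ← hdeg, coeff_natDegree]
    exact leadingCoeff_ne_zero.2 hv
  exact mul_right_cancel₀ hc (by linarith)

theorem posDef_hankel_of_atomic {ι : Type*} {S : Finset ι} {z w : ι → ℝ}
    (hz : Set.InjOn z S) (hw : ∀ s ∈ S, 0 < w s) {m : ℕ} (hm : m ≤ #S) {g : ℕ → ℝ}
    (hg : ∀ j < 2 * m - 1, g j = ∑ s ∈ S, w s * z s ^ j) :
    (Matrix.of fun i j : Fin m => g (i.1 + j.1)).PosDef := by
  rw [posDef_hankel_iff]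
  intro p hp hpm
  rw [momentFunctional_congr hg (natDegree_mul_le.trans_lt (by omega)), momentFunctional_atomic]
  simp only [eval_mul]
  refine sum_pos' (fun s hs => mul_nonneg (hw s hs).le (mul_self_nonneg _)) ?_
  by_contra! h
  refine hp (eq_zero_of_degree_lt_of_eval_index_eq_zero S hz ?_ fun s hs => ?_)
  · exact degree_le_natDegree.trans_lt (by exact_mod_cast hpm.trans_le hm)
  · by_contra h0
    exact (h s hs).not_gt (mul_pos (hw s hs) (mul_self_pos.2 h0))

theorem det_hankel_eq_zero_of_atomic {ι : Type*} {S : Finset ι} {z w : ι → ℝ} {m : ℕ}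
    (hm : #S < m) {g : ℕ → ℝ} (hg : ∀ j < 2 * m - 1, g j = ∑ s ∈ S, w s * z s ^ j) :
    (Matrix.of fun i j : Fin m => g (i.1 + j.1)).det = 0 := by
  rw [det_hankel_eq_zero_iff]
  refine ⟨Lagrange.nodal S z, Lagrange.nodal_ne_zero, by rwa [Lagrange.natDegree_nodal],
    fun r hr => ?_⟩
  have : (Lagrange.nodal S z).natDegree = #S := Lagrange.natDegree_nodal
  rw [momentFunctional_congr hg (natDegree_mul_le.trans_lt (by omega)), momentFunctional_atomic]
  exact sum_eq_zero fun s hs => by rw [eval_mul, Lagrange.eval_nodal_at_node hs]; ring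

theorem exists_strictAntiOn_image_eq {T : Finset ℝ} {k : ℕ} (hT : #T = k - 1) :
    ∃ z : ℕ → ℝ, StrictAntiOn z (Icc 2 k) ∧ (Icc 2 k).image z = T := by
  let z : ℕ → ℝ := fun s => if h : k - s < k - 1 then T.orderEmbOfFin hT ⟨k - s, h⟩ else 0
  have hz : StrictAntiOn z (Icc 2 k) := by
    intro s hs t ht hst
    rw [coe_Icc, Set.mem_Icc] at hs ht
    have h1 : k - s < k - 1 := by omega
    have h2 : k - t < k - 1 := by omega
    simp only [z, h1, h2, dif_pos]
    exact (T.orderEmbOfFin hT).strictMono (Fin.mk_lt_mk.2 (by omega))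
  refine ⟨z, hz, eq_of_subset_of_card_le (fun x hx => ?_) ?_⟩
  · obtain ⟨s, hs, rfl⟩ := mem_image.1 hx
    rw [mem_Icc] at hs
    have h1 : k - s < k - 1 := by omega
    simp only [z, h1, dif_pos]
    exact orderEmbOfFin_mem _ _ _
  · rw [card_image_of_injOn hz.injOn, Nat.card_Icc, hT]
    omega

theorem hankel_conditions_of_representation {n k : ℕ} (hk : 1 ≤ k) (hkn : 2 * k ≤ n)
    {a b : ℝ} (hab : a < b) {c z σ : ℕ → ℝ} (hanti : StrictAntiOn z (Icc 2 k))
    (hz : ∀ s ∈ Icc 2 k, a < z s ∧ z s < b) (hz0 : ∀ s ∈ Icc 2 k, z s ≠ 0)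
    (hσ : ∀ s ∈ Icc 1 k, 0 < σ s)
    (hc : ∀ j < n, c (j + 1) = b ^ j * σ 1 + ∑ s ∈ Icc 2 k, z s ^ j * σ s) :
    (∀ d : ℕ, 2 * k + d ≤ n →
        (Matrix.of fun i j : Fin k =>
          -c (i.1 + j.1 + 2 + d) + b * c (i.1 + j.1 + 1 + d)).det = 0) ∧
      (Matrix.of fun i j : Fin (k - 1) =>
        -c (i.1 + j.1 + 2) + b * c (i.1 + j.1 + 1)).PosDef ∧
      (Matrix.of fun i j : Fin (k - 1) =>
        -c (i.1 + j.1 + 4) + b * c (i.1 + j.1 + 3)).PosDef ∧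
      (Matrix.of fun i j : Fin k =>
        c (i.1 + j.1 + 2) - a * c (i.1 + j.1 + 1)).PosDef := by
  have hcard : #(Icc 2 k) = k - 1 := by rw [Nat.card_Icc]; omega
  have hσ' : ∀ s ∈ Icc 2 k, 0 < σ s := fun s hs => hσ s (Icc_subset_Icc (by simp) le_rfl hs)
  have hg : ∀ j d, j + d + 1 < n → -c (j + d + 1 + 1) + b * c (j + d + 1) =
      ∑ s ∈ Icc 2 k, z s ^ d * (b - z s) * σ s * z s ^ j := by
    intro j d hj
    rw [hc _ hj, hc _ (by omega)]
    have : ∑ s ∈ Icc 2 k, z s ^ d * (b - z s) * σ s * z s ^ j =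
        b * ∑ s ∈ Icc 2 k, z s ^ (j + d) * σ s - ∑ s ∈ Icc 2 k, z s ^ (j + d + 1) * σ s := by
      rw [mul_sum, ← sum_sub_distrib]
      exact sum_congr rfl fun s _ => by ring
    rw [this]
    ring
  refine ⟨fun d hd => ?_, ?_, ?_, ?_⟩
  · refine det_hankel_eq_zero_of_atomic (S := Icc 2 k) (z := z)
      (w := fun s => z s ^ d * (b - z s) * σ s) (by omega)
      (g := fun j => -c (j + 2 + d) + b * c (j + 1 + d)) fun j hj => ?_
    rw [← hg j d (by omega)]
    ring_nf
  · refine posDef_hankel_of_atomic (S := Icc 2 k) (w := fun s => z s ^ 0 * (b - z s) * σ s)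
      hanti.injOn (fun s hs => ?_) hcard.ge
      (g := fun j => -c (j + 2) + b * c (j + 1)) fun j hj => hg j 0 (by omega)
    rw [pow_zero, one_mul]
    exact mul_pos (sub_pos.2 (hz s hs).2) (hσ' s hs)
  · refine posDef_hankel_of_atomic (S := Icc 2 k) (w := fun s => z s ^ 2 * (b - z s) * σ s)
      hanti.injOn (fun s hs => ?_) hcard.ge
      (g := fun j => -c (j + 4) + b * c (j + 3)) fun j hj => hg j 2 (by omega)
    have := hz0 s hs
    exact mul_pos (mul_pos (by positivity) (sub_pos.2 (hz s hs).2)) (hσ' s hs)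
  · have hins : Icc 1 k = insert 1 (Icc 2 k) := by
      ext s
      simp only [mem_Icc, mem_insert]
      omega
    have h1 : 1 ∉ Icc 2 k := by simp
    let y : ℕ → ℝ := Function.update z 1 b
    have hy1 : y 1 = b := Function.update_self _ _ _
    have hy : ∀ s ∈ Icc 2 k, y s = z s := fun s hs =>
      Function.update_of_ne (ne_of_mem_of_not_mem hs h1) _ _
    have hinj : Set.InjOn y (Icc 1 k : Finset ℕ) := by
      rw [hins, coe_insert, Set.injOn_insert h1]
      refine ⟨fun s hs t ht hst => hanti.injOn hs ht ?_, ?_⟩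
      · rwa [← hy s (mem_coe.1 hs), ← hy t (mem_coe.1 ht)]
      · rintro ⟨s, hs, hsb⟩
        rw [hy1, hy s (mem_coe.1 hs)] at hsb
        exact (hz s (mem_coe.1 hs)).2.ne hsb
    refine posDef_hankel_of_atomic (S := Icc 1 k) (w := fun s => (y s - a) * σ s)
      hinj (fun s hs => mul_pos (sub_pos.2 ?_) (hσ s hs)) (by simp)
      (g := fun j => c (j + 2) - a * c (j + 1)) fun j hj => ?_
    · rw [hins, mem_insert] at hs
      rcases hs with rfl | hs
      · rwa [hy1]
      · rw [hy s hs]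
        exact (hz s hs).1
    · rw [hins, sum_insert h1, hy1, sum_congr rfl fun s hs => by rw [hy s hs], hc _ (by omega),
        hc _ (by omega)]
      have : ∑ s ∈ Icc 2 k, (z s - a) * σ s * z s ^ j =
          ∑ s ∈ Icc 2 k, z s ^ (j + 1) * σ s - a * ∑ s ∈ Icc 2 k, z s ^ j * σ s := by
        rw [mul_sum, ← sum_sub_distrib]
        exact sum_congr rfl fun s _ => by ring
      rw [this]
      ring

theorem exists_atoms_of_hankel_conditions {n k : ℕ} (hk : 1 ≤ k) (hkn : 2 * k ≤ n)
    {a b : ℝ} (hab : a < b) {c : ℕ → ℝ}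
    (hdet : ∀ d : ℕ, 2 * k + d ≤ n →
        (Matrix.of fun i j : Fin k =>
          -c (i.1 + j.1 + 2 + d) + b * c (i.1 + j.1 + 1 + d)).det = 0)
    (hpos : (Matrix.of fun i j : Fin (k - 1) =>
        -c (i.1 + j.1 + 2) + b * c (i.1 + j.1 + 1)).PosDef)
    (hpos2 : (Matrix.of fun i j : Fin (k - 1) =>
        -c (i.1 + j.1 + 4) + b * c (i.1 + j.1 + 3)).PosDef)
    (hposa : (Matrix.of fun i j : Fin k =>
        c (i.1 + j.1 + 2) - a * c (i.1 + j.1 + 1)).PosDef) :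
    ∃ (T : Finset ℝ) (σ₁ : ℝ) (σ : ℝ → ℝ), #T = k - 1 ∧ (∀ t ∈ T, a < t ∧ t < b) ∧
      (∀ t ∈ T, t ≠ 0) ∧ 0 < σ₁ ∧ (∀ t ∈ T, 0 < σ t) ∧
      ∀ j < n, c (j + 1) = b ^ j * σ₁ + ∑ t ∈ T, t ^ j * σ t := by
  obtain ⟨m, rfl⟩ := Nat.exists_eq_add_of_le' hk
  rw [Nat.add_sub_cancel] at *
  set g : ℕ → ℝ := fun j => -c (j + 2) + b * c (j + 1) with hg
  set e : ℕ → ℝ := fun j => c (j + 2) - a * c (j + 1) with he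
  have hdet' : ∀ d, 2 * m + d < n - 1 →
      (Matrix.of fun i j : Fin (m + 1) => g (i.1 + j.1 + d)).det = 0 := fun d hd => by
    rw [← hdet d (by omega)]
    congr 2
    ext i j
    simp only [hg]
    ring_nf
  have hpos' := (posDef_hankel_iff g m).1 hpos
  have hpos2' := (posDef_hankel_iff (fun j => g (j + 2)) m).1 hpos2
  have hposa' := (posDef_hankel_iff e (m + 1)).1 hposa
  simp only [momentFunctional_shift] at hpos2'
  obtain ⟨q, hq, hqm, horth⟩ := (det_hankel_eq_zero_iff g (m + 1)).1 (hdet' 0 (by omega))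
  obtain ⟨T, τ, hcard, hτ, hroot, hrep⟩ := exists_gauss_quadrature hpos' hq hqm horth
  have hT0 : ∀ t ∈ T, t ≠ 0 := by
    rintro t ht rfl
    obtain ⟨h, rfl⟩ := dvd_iff_isRoot.2 (hroot 0 ht)
    have hh : h ≠ 0 := right_ne_zero_of_mul hq
    rw [natDegree_mul (left_ne_zero_of_mul hq) hh, natDegree_X_sub_C] at hqm
    have h1 := hpos2' h hh (by omega)
    have h2 := horth (X * h) (natDegree_mul_le.trans_lt (by rw [natDegree_X]; omega))
    rw [C_0, sub_zero, show X * h * (X * h) = X ^ 2 * (h * h) by ring] at h2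
    exact h1.ne' h2
  have hgsum : ∀ j < n - 1, g j = ∑ t ∈ T, τ t * t ^ j := by
    refine eq_sum_of_det_hankel_eq_zero hcard (fun t ht => (hτ t ht).ne') hT0 (fun j hj => ?_) hdet'
    have := hrep (X ^ j) (by rwa [natDegree_X_pow])
    simpa using this
  have hswap : ∀ p : ℝ[X], momentFunctional e ((X - C b) * p) =
      -momentFunctional g ((X - C a) * p) := by
    intro p
    have : momentFunctional e ∘ₗ LinearMap.mulLeft ℝ (X - C b) =
        -(momentFunctional g ∘ₗ LinearMap.mulLeft ℝ (X - C a)) := by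
      ext j
      simp only [LinearMap.comp_apply, LinearMap.mulLeft_apply, LinearMap.neg_apply,
        ← X_pow_eq_monomial, sub_mul, ← pow_succ', map_sub, ← smul_eq_C_mul, map_smul,
        momentFunctional_X_pow, smul_eq_mul, hg, he]
      ring
    exact LinearMap.congr_fun this p
  have hTab : ∀ t ∈ T, a < t ∧ t < b := by
    intro t ht
    have hb := natDegree_basis_id ht
    set l := Lagrange.basis T id t with hl
    have hl0 : l ≠ 0 := Lagrange.basis_ne_zero (Set.injOn_id _) ht
    have h1 := hposa' ((X - C b) * l) (mul_ne_zero (X_sub_C_ne_zero _) hl0)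
      (natDegree_mul_le.trans_lt (by rw [natDegree_X_sub_C]; omega))
    rw [mul_assoc, hswap, ← mul_assoc, ← mul_assoc, hrep, sum_mul_eval_mul_basis ht] at h1
    · have h2 : l.eval t = 1 := Lagrange.eval_basis_self (Set.injOn_id (T : Set ℝ)) ht
      simp only [eval_mul, eval_sub, eval_X, eval_C, h2] at h1
      have h3 := hτ t ht
      have h4 : 0 < (t - a) * (b - t) := by
        by_contra! h
        nlinarith
      rcases pos_and_pos_or_neg_and_neg_of_mul_pos h4 with h | h
      · constructor <;> linarith
      · linarith
    · compute_degree
      omega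
  let σ : ℝ → ℝ := fun t => τ t / (b - t)
  let σ₁ : ℝ := c 1 - ∑ t ∈ T, σ t
  have hσ : ∀ t ∈ T, 0 < σ t := fun t ht => div_pos (hτ t ht) (sub_pos.2 (hTab t ht).2)
  have hsum : ∀ j < n, c (j + 1) = b ^ j * σ₁ + ∑ t ∈ T, t ^ j * σ t := by
    intro j
    induction j with
    | zero => simp [σ₁]
    | succ j ih =>
      intro hj
      have h1 := hgsum j (by omega)
      have h2 : ∑ t ∈ T, τ t * t ^ j =
          b * ∑ t ∈ T, t ^ j * σ t - ∑ t ∈ T, t ^ (j + 1) * σ t := by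
        rw [mul_sum, ← sum_sub_distrib]
        refine sum_congr rfl fun t ht => ?_
        have := (sub_pos.2 (hTab t ht).2).ne'
        simp only [σ]
        field_simp
        ring
      have h3 := ih (by omega)
      simp only [hg] at h1
      rw [h2, h3] at h1
      linear_combination -h1
  refine ⟨T, σ₁, σ, hcard, hTab, hT0, ?_, hσ, hsum⟩
  have h1 := hposa' q hq hqm
  have hesum : ∀ j < 2 * m + 1, e j = ∑ t ∈ insert b T,
      Function.update (fun t => (t - a) * σ t) b ((b - a) * σ₁) t * t ^ j := by
    intro j hj
    have hbT : b ∉ T := fun hb => (hTab b hb).2.false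
    rw [sum_insert hbT, Function.update_self, sum_congr rfl fun t ht => by
      rw [Function.update_of_ne (ne_of_mem_of_not_mem ht hbT)]]
    simp only [he]
    rw [hsum _ (by omega), hsum _ (by omega)]
    have : ∑ t ∈ T, (t - a) * σ t * t ^ j =
        ∑ t ∈ T, t ^ (j + 1) * σ t - a * ∑ t ∈ T, t ^ j * σ t := by
      rw [mul_sum, ← sum_sub_distrib]
      exact sum_congr rfl fun s _ => by ring
    rw [this]
    ring
  rw [momentFunctional_congr hesum (natDegree_mul_le.trans_lt (by omega)),
    momentFunctional_atomic (z := fun t => t)] at h1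
  rw [sum_insert fun hb => (hTab b hb).2.false, Function.update_self,
    sum_eq_zero fun t ht => by rw [eval_mul, hroot t ht]; ring, add_zero, eval_mul] at h1
  by_contra! h
  have h2 := mul_self_nonneg (q.eval b)
  have h3 : (b - a) * σ₁ ≤ 0 := mul_nonpos_of_nonneg_of_nonpos (sub_pos.2 hab).le h
  exact h1.not_ge (mul_nonpos_of_nonpos_of_nonneg h3 h2)

end

open Finset

/-- Part (C) of the solvability lemma for the truncated Hausdorff moment problem:
existence of a representing step function with exactly `k` nonzero points of growth,
including `b` but not `a`, for moments `c₁, …, c_n`. -/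
theorem stmt_4 (n k : ℕ) (hn : 4 ≤ n) (hk : 1 ≤ k) (hkn : 2 * k ≤ n)
    (a b : ℝ) (hab : a < b) (c : ℕ → ℝ) :
    (∃ z σ : ℕ → ℝ,
      (∀ s ∈ Icc 2 k, ∀ t ∈ Icc 2 k, s < t → z t < z s) ∧
      (∀ s ∈ Icc 2 k, a < z s ∧ z s < b) ∧
      (∀ s ∈ Icc 2 k, z s ≠ 0) ∧
      (∀ s ∈ Icc 1 k, 0 < σ s) ∧
      (∀ j ∈ Icc 1 n, c j = b ^ (j - 1) * σ 1 + ∑ s ∈ Icc 2 k, z s ^ (j - 1) * σ s))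
    ↔
    ((∀ d : ℕ, 2 * k + d ≤ n →
        (Matrix.of fun i j : Fin k =>
          -c (i.1 + j.1 + 2 + d) + b * c (i.1 + j.1 + 1 + d)).det = 0) ∧
      (Matrix.of fun i j : Fin (k - 1) =>
        -c (i.1 + j.1 + 2) + b * c (i.1 + j.1 + 1)).PosDef ∧
      (Matrix.of fun i j : Fin (k - 1) =>
        -c (i.1 + j.1 + 4) + b * c (i.1 + j.1 + 3)).PosDef ∧
      (Matrix.of fun i j : Fin k =>
        c (i.1 + j.1 + 2) - a * c (i.1 + j.1 + 1)).PosDef) := by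
  constructor
  · rintro ⟨z, σ, hanti, hz, hz0, hσ, hc⟩
    refine hankel_conditions_of_representation hk hkn hab
      (fun s hs t ht => hanti s (mem_coe.1 hs) t (mem_coe.1 ht)) hz hz0 hσ fun j hj => ?_
    exact hc (j + 1) (mem_Icc.2 ⟨by omega, hj⟩)
  · rintro ⟨hdet, hpos, hpos2, hposa⟩
    obtain ⟨T, σ₁, σ, hcard, hTab, hT0, hσ₁, hσ, hc⟩ :=
      exists_atoms_of_hankel_conditions hk hkn hab hdet hpos hpos2 hposa
    obtain ⟨z, hz, rfl⟩ := exists_strictAntiOn_image_eq hcard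
    have hmem : ∀ s ∈ Icc 2 k, z s ∈ (Icc 2 k).image z := fun s hs => mem_image_of_mem z hs
    have h1 : ∀ s ∈ Icc 2 k, s ≠ 1 := fun s hs => by
      rw [mem_Icc] at hs
      omega
    refine ⟨z, Function.update (fun s => σ (z s)) 1 σ₁,
      fun s hs t ht hst => hz (mem_coe.2 hs) (mem_coe.2 ht) hst, fun s hs => hTab _ (hmem s hs),
      fun s hs => hT0 _ (hmem s hs), fun s hs => ?_, fun j hj => ?_⟩
    · by_cases h : s = 1
      · rwa [h, Function.update_self]
      · rw [Function.update_of_ne h]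
        refine hσ _ (hmem s ?_)
        rw [mem_Icc] at hs ⊢
        omega
    · rw [mem_Icc] at hj
      obtain ⟨j, rfl⟩ := Nat.exists_eq_add_of_le' hj.1
      rw [hc j (by omega), sum_image hz.injOn, Function.update_self, Nat.add_sub_cancel]
      congr 1
      exact sum_congr rfl fun s hs => by rw [Function.update_of_ne (h1 s hs)]
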